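/- arXiv:0804.4764 — 2 statements merged into one kernel-verified Lean document; each statement's English description precedes it below -/
import Mathlib

section
/- Let (I, δ₁, δ₂) and (I, σ₁, σ₂) be two regular quasi P-configurations such that σ₁'(t) < 1, σ₂'(t) < 1, δ₁'(t) < 1, and δ₂'(t) < 1 for all t ∈ I. Then the unique continuous map h : I → I with h(-1) = -1, h(0) = 0, h(1) = 1 and h(δᵢ(t)) = σᵢ(h(t)) (i = 1,2, t ∈ I) is a homeomorphism of I onto I; in particular (I, δ₁, δ₂) and (I, σ₁, σ₂) are conjugate. -/
open Set

/-- The interval `I = [-1, 1]`. -/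
def Iseg : Set ℝ := Set.Icc (-1) 1

/-- `δ₁, δ₂ : I → I` (with derivative functions `d₁, d₂` on `I`) form a *regular quasi
P-configuration* in `I = [-1,1]`: they are `C¹` with strictly positive derivatives and the
endpoint conditions hold (the condition `d₁ + d₂ = 1` is not required). -/
structure RegQuasiPConfig (δ₁ δ₂ d₁ d₂ : ℝ → ℝ) : Prop where
  maps₁ : MapsTo δ₁ Iseg Iseg
  maps₂ : MapsTo δ₂ Iseg Iseg
  hasDeriv₁ : ∀ t ∈ Iseg, HasDerivWithinAt δ₁ (d₁ t) Iseg t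
  hasDeriv₂ : ∀ t ∈ Iseg, HasDerivWithinAt δ₂ (d₂ t) Iseg t
  contDeriv₁ : ContinuousOn d₁ Iseg
  contDeriv₂ : ContinuousOn d₂ Iseg
  derivPos₁ : ∀ t ∈ Iseg, 0 < d₁ t
  derivPos₂ : ∀ t ∈ Iseg, 0 < d₂ t
  fix₂ : δ₂ (-1) = -1
  mid₂ : δ₂ 1 = 0
  mid₁ : δ₁ (-1) = 0
  fix₁ : δ₁ 1 = 1

/-- `h` restricts to a homeomorphism of `I = [-1,1]` onto itself: it is continuous on `I`,
maps `I` into `I`, and has a continuous inverse `g : I → I`. -/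
def IsHomeoOfIcc (h : ℝ → ℝ) : Prop :=
  ContinuousOn h Iseg ∧ MapsTo h Iseg Iseg ∧
    ∃ g : ℝ → ℝ, ContinuousOn g Iseg ∧ MapsTo g Iseg Iseg ∧
      (∀ t ∈ Iseg, g (h t) = t) ∧ (∀ t ∈ Iseg, h (g t) = t)

open BoundedContinuousFunction

lemma isCompact_Iseg : IsCompact Iseg := isCompact_Icc

lemma Iseg_nonempty : Iseg.Nonempty := nonempty_Icc.2 (by norm_num)

/-- A differentiable function on `I` with continuous derivative in `(0, 1)` is a contraction. -/
lemma exists_lipschitzOnWith_lt_one {f f' : ℝ → ℝ}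
    (hf : ∀ t ∈ Iseg, HasDerivWithinAt f (f' t) Iseg t) (hf' : ContinuousOn f' Iseg)
    (hpos : ∀ t ∈ Iseg, 0 < f' t) (hlt : ∀ t ∈ Iseg, f' t < 1) :
    ∃ K : NNReal, K < 1 ∧ LipschitzOnWith K f Iseg := by
  obtain ⟨c, hc, hmax⟩ := isCompact_Iseg.exists_isMaxOn Iseg_nonempty hf'
  refine ⟨(f' c).toNNReal, Real.toNNReal_lt_one.2 (hlt c hc), ?_⟩
  have hconv : Convex ℝ Iseg := convex_Icc _ _
  refine hconv.lipschitzOnWith_of_nnnorm_hasDerivWithin_le hf fun t ht => ?_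
  rw [← NNReal.coe_le_coe, coe_nnnorm, Real.coe_toNNReal _ (hpos c hc).le,
    Real.norm_of_nonneg (hpos t ht).le]
  exact hmax ht

lemma strictMonoOn_Iseg_of_deriv_pos {f f' : ℝ → ℝ}
    (hf : ∀ t ∈ Iseg, HasDerivWithinAt f (f' t) Iseg t) (hpos : ∀ t ∈ Iseg, 0 < f' t) :
    StrictMonoOn f Iseg := by
  refine strictMonoOn_of_hasDerivWithinAt_pos (f' := f') (convex_Icc (-1 : ℝ) 1)
    (fun t ht => (hf t ht).continuousWithinAt) (fun t ht => ?_) fun t ht => ?_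
  · exact (hf t (interior_subset ht)).mono interior_subset
  · exact hpos t (interior_subset ht)

/-- A strictly increasing continuous function on `I` has a continuous left inverse defined on
the whole line, constant on both sides of the image. -/
lemma exists_continuous_leftInverse {f : ℝ → ℝ} (hc : ContinuousOn f Iseg)
    (hm : StrictMonoOn f Iseg) :
    ∃ g : ℝ → ℝ, Continuous g ∧ (∀ t, g t ∈ Iseg) ∧ (∀ t ∈ Iseg, g (f t) = t) ∧
      (∀ t ≤ f (-1), g t = -1) ∧ ∀ t, f 1 ≤ t → g t = 1 := by
  have hl : (-1 : ℝ) ∈ Iseg := left_mem_Icc.2 (by norm_num)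
  have hr : (1 : ℝ) ∈ Iseg := right_mem_Icc.2 (by norm_num)
  have hle : f (-1) ≤ f 1 := hm.monotoneOn hl hr (by norm_num)
  have hmaps : ∀ t ∈ Iseg, f t ∈ Icc (f (-1)) (f 1) := fun t ht =>
    ⟨hm.monotoneOn hl ht ht.1, hm.monotoneOn ht hr ht.2⟩
  let F : Iseg → Icc (f (-1)) (f 1) := fun t => ⟨f t, hmaps t t.2⟩
  have hF : StrictMono F := fun s t hst => hm s.2 t.2 hst
  have hsurj : Function.Surjective F := fun y => by
    obtain ⟨s, hs, hsy⟩ := intermediate_value_Icc (by norm_num : (-1 : ℝ) ≤ 1) hc y.2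
    exact ⟨⟨s, hs⟩, Subtype.ext hsy⟩
  let e := hF.orderIsoOfSurjective F hsurj
  have : OrdConnected Iseg := ordConnected_Icc
  have he : ∀ t (ht : t ∈ Iseg) (y : ℝ), projIcc _ _ hle y = F ⟨t, ht⟩ →
      (e.symm (projIcc _ _ hle y) : ℝ) = t := fun t ht y hy => by
    rw [hy, show F ⟨t, ht⟩ = e ⟨t, ht⟩ from rfl, OrderIso.symm_apply_apply]
  refine ⟨fun t => e.symm (projIcc _ _ hle t), ?_, fun t => (e.symm _).2, fun t ht => ?_,
    fun t ht => ?_, fun t ht => ?_⟩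
  · exact continuous_subtype_val.comp (e.symm.continuous.comp continuous_projIcc)
  · exact he t ht _ (projIcc_of_mem hle (hmaps t ht))
  · exact he _ hl _ (projIcc_of_le_left hle ht)
  · exact he _ hr _ (projIcc_of_right_le hle ht)

/-- The images of the two branches cover `I`. -/
lemma RegQuasiPConfig.exists_preimage {δ₁ δ₂ d₁ d₂ : ℝ → ℝ} (hδ : RegQuasiPConfig δ₁ δ₂ d₁ d₂)
    {t : ℝ} (ht : t ∈ Iseg) :
    (0 ≤ t ∧ ∃ s ∈ Iseg, δ₁ s = t) ∨ (t ≤ 0 ∧ ∃ s ∈ Iseg, δ₂ s = t) := by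
  rcases le_total 0 t with h | h
  · exact .inl ⟨h, intermediate_value_Icc (by norm_num : (-1 : ℝ) ≤ 1)
      (fun t ht => (hδ.hasDeriv₁ t ht).continuousWithinAt)
      ⟨hδ.mid₁.trans_le h, ht.2.trans_eq hδ.fix₁.symm⟩⟩
  · exact .inr ⟨h, intermediate_value_Icc (by norm_num : (-1 : ℝ) ≤ 1)
      (fun t ht => (hδ.hasDeriv₂ t ht).continuousWithinAt)
      ⟨hδ.fix₂.trans_le ht.1, h.trans_eq hδ.mid₂.symm⟩⟩

/-- `h` is a continuous self-map of `I` intertwining `(δ₁, δ₂)` with `(σ₁, σ₂)`. -/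
structure Intertwines (δ₁ δ₂ σ₁ σ₂ h : ℝ → ℝ) : Prop where
  continuousOn : ContinuousOn h Iseg
  mapsTo : MapsTo h Iseg Iseg
  comm₁ : ∀ t ∈ Iseg, h (δ₁ t) = σ₁ (h t)
  comm₂ : ∀ t ∈ Iseg, h (δ₂ t) = σ₂ (h t)

lemma Intertwines.comp {δ₁ δ₂ σ₁ σ₂ τ₁ τ₂ h g : ℝ → ℝ}
    (hg : Intertwines σ₁ σ₂ τ₁ τ₂ g)
    (hh : Intertwines δ₁ δ₂ σ₁ σ₂ h) : Intertwines δ₁ δ₂ τ₁ τ₂ (g ∘ h) where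
  continuousOn := hg.continuousOn.comp hh.continuousOn hh.mapsTo
  mapsTo := hg.mapsTo.comp hh.mapsTo
  comm₁ t ht := by simp [hh.comm₁ t ht, hg.comm₁ _ (hh.mapsTo ht)]
  comm₂ t ht := by simp [hh.comm₂ t ht, hg.comm₂ _ (hh.mapsTo ht)]

lemma LipschitzOnWith.dist_eq_zero_of_dist_le {f : ℝ → ℝ} {s : Set ℝ} {K : NNReal}
    (hf : LipschitzOnWith K f s) (hK : K < 1) {x y : ℝ} (hx : x ∈ s) (hy : y ∈ s)
    (h : dist x y ≤ dist (f x) (f y)) : dist (f x) (f y) = 0 := by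
  have h1 := hf.dist_le_mul x hx y hy
  have h2 : (K : ℝ) < 1 := hK
  nlinarith [dist_nonneg (x := x) (y := y), dist_nonneg (x := f x) (y := f y), K.coe_nonneg]

/-- Continuous intertwining maps into a contracting system are unique. -/
lemma Intertwines.eqOn {δ₁ δ₂ d₁ d₂ σ₁ σ₂ h k : ℝ → ℝ} (hδ : RegQuasiPConfig δ₁ δ₂ d₁ d₂)
    {K₁ K₂ : NNReal} (hK₁ : K₁ < 1) (hK₂ : K₂ < 1) (hσ₁ : LipschitzOnWith K₁ σ₁ Iseg)
    (hσ₂ : LipschitzOnWith K₂ σ₂ Iseg) (hh : Intertwines δ₁ δ₂ σ₁ σ₂ h)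
    (hk : Intertwines δ₁ δ₂ σ₁ σ₂ k) : EqOn h k Iseg := by
  obtain ⟨c, hc, hmax⟩ := isCompact_Iseg.exists_isMaxOn Iseg_nonempty
    (f := fun t => dist (h t) (k t))
    (continuous_dist.comp_continuousOn (hh.continuousOn.prodMk hk.continuousOn))
  have hzero : dist (h c) (k c) = 0 := by
    rcases hδ.exists_preimage hc with ⟨-, s, hs, rfl⟩ | ⟨-, s, hs, rfl⟩
    · have := isMaxOn_iff.1 hmax s hs
      simp only [hh.comm₁ s hs, hk.comm₁ s hs] at this ⊢
      exact hσ₁.dist_eq_zero_of_dist_le hK₁ (hh.mapsTo hs) (hk.mapsTo hs) this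
    · have := isMaxOn_iff.1 hmax s hs
      simp only [hh.comm₂ s hs, hk.comm₂ s hs] at this ⊢
      exact hσ₂.dist_eq_zero_of_dist_le hK₂ (hh.mapsTo hs) (hk.mapsTo hs) this
  intro t ht
  exact dist_le_zero.1 ((isMaxOn_iff.1 hmax t ht).trans_eq hzero)

/-- The bounded continuous functions on the line with values in `I` fixing both endpoints. -/
def endpointFixing : Set (ℝ →ᵇ ℝ) :=
  {f | (∀ t, f t ∈ Iseg) ∧ f (-1) = -1 ∧ f 1 = 1}

lemma isClosed_endpointFixing : IsClosed endpointFixing := by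
  have hev : ∀ t : ℝ, Continuous fun f : ℝ →ᵇ ℝ => f t := fun t => continuous_eval_const t
  have hset : endpointFixing =
      (⋂ t, {f : ℝ →ᵇ ℝ | f t ∈ Iseg}) ∩ ({f | f (-1) = -1} ∩ {f | f 1 = 1}) := by
    ext f
    simp [endpointFixing]
  rw [hset]
  refine IsClosed.inter ?_ (IsClosed.inter ?_ ?_)
  · exact isClosed_iInter fun t => isClosed_Icc.preimage (hev t)
  · exact isClosed_eq (hev _) continuous_const
  · exact isClosed_eq (hev _) continuous_const

lemma endpointFixing_nonempty : endpointFixing.Nonempty := by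
  have hle : (-1 : ℝ) ≤ 1 := by norm_num
  have hmem : ∀ t : ℝ, (projIcc (-1) 1 hle t : ℝ) ∈ Iseg := fun t => (projIcc _ _ hle t).2
  refine ⟨ofNormedAddCommGroup (fun t => (projIcc (-1) 1 hle t : ℝ))
    (continuous_subtype_val.comp continuous_projIcc) 1 fun t => abs_le.2 (hmem t), hmem, ?_, ?_⟩
  · simp [projIcc_left]
  · simp [projIcc_right]

/-- A contracting system receives an intertwining map fixing the endpoints: the fixed point of
`f ↦ σ₁ ∘ f ∘ δ₁⁻¹ + σ₂ ∘ f ∘ δ₂⁻¹`, with the inverses extended by constants. -/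
lemma exists_intertwines {δ₁ δ₂ d₁ d₂ σ₁ σ₂ e₁ e₂ : ℝ → ℝ}
    (hδ : RegQuasiPConfig δ₁ δ₂ d₁ d₂) (hσ : RegQuasiPConfig σ₁ σ₂ e₁ e₂)
    {K₁ K₂ : NNReal} (hK₁ : K₁ < 1) (hK₂ : K₂ < 1) (hσ₁ : LipschitzOnWith K₁ σ₁ Iseg)
    (hσ₂ : LipschitzOnWith K₂ σ₂ Iseg) :
    ∃ h, Intertwines δ₁ δ₂ σ₁ σ₂ h ∧ h (-1) = -1 ∧ h 1 = 1 := by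
  have hl : (-1 : ℝ) ∈ Iseg := left_mem_Icc.2 (by norm_num)
  have hr : (1 : ℝ) ∈ Iseg := right_mem_Icc.2 (by norm_num)
  obtain ⟨g₁, hg₁, hgI₁, hinv₁, hleft₁, hright₁⟩ := exists_continuous_leftInverse
    (fun t ht => (hδ.hasDeriv₁ t ht).continuousWithinAt)
    (strictMonoOn_Iseg_of_deriv_pos hδ.hasDeriv₁ hδ.derivPos₁)
  obtain ⟨g₂, hg₂, hgI₂, hinv₂, hleft₂, hright₂⟩ := exists_continuous_leftInverse
    (fun t ht => (hδ.hasDeriv₂ t ht).continuousWithinAt)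
    (strictMonoOn_Iseg_of_deriv_pos hδ.hasDeriv₂ hδ.derivPos₂)
  rw [hδ.mid₁] at hleft₁
  rw [hδ.fix₁] at hright₁
  rw [hδ.fix₂] at hleft₂
  rw [hδ.mid₂] at hright₂
  let Φ : endpointFixing → ℝ → ℝ := fun f t => σ₁ (f.1 (g₁ t)) + σ₂ (f.1 (g₂ t))
  have hpos : ∀ f t, 0 ≤ t → Φ f t = σ₁ (f.1 (g₁ t)) := fun f t ht => by
    simp [Φ, hright₂ t ht, f.2.2.2, hσ.mid₂]
  have hneg : ∀ f t, t ≤ 0 → Φ f t = σ₂ (f.1 (g₂ t)) := fun f t ht => by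
    simp [Φ, hleft₁ t ht, f.2.2.1, hσ.mid₁]
  have hmem : ∀ f t, Φ f t ∈ Iseg := fun f t => by
    rcases le_total 0 t with ht | ht
    · rw [hpos f t ht]; exact hσ.maps₁ (f.2.1 _)
    · rw [hneg f t ht]; exact hσ.maps₂ (f.2.1 _)
  have hcont : ∀ f, Continuous (Φ f) := fun f =>
    (hσ₁.continuousOn.comp_continuous (f.1.continuous.comp hg₁) fun t => f.2.1 _).add
      (hσ₂.continuousOn.comp_continuous (f.1.continuous.comp hg₂) fun t => f.2.1 _)
  let T : endpointFixing → endpointFixing := fun f =>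
    ⟨ofNormedAddCommGroup (Φ f) (hcont f) 1 fun t => abs_le.2 (hmem f t), hmem f,
      (hneg f _ (by norm_num)).trans (by rw [hleft₂ _ le_rfl, f.2.2.1, hσ.fix₂]),
      (hpos f _ (by norm_num)).trans (by rw [hright₁ _ le_rfl, f.2.2.2, hσ.fix₁])⟩
  have hT : ContractingWith (max K₁ K₂) T := by
    refine ⟨max_lt hK₁ hK₂, LipschitzWith.of_dist_le_mul fun f k => ?_⟩
    refine (BoundedContinuousFunction.dist_le (by positivity)).2 fun t => ?_
    change dist (Φ f t) (Φ k t) ≤ _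
    rcases le_total 0 t with ht | ht
    · rw [hpos f t ht, hpos k t ht]
      refine (hσ₁.dist_le_mul _ (f.2.1 _) _ (k.2.1 _)).trans ?_
      exact mul_le_mul (NNReal.coe_le_coe.2 (le_max_left _ _))
        (BoundedContinuousFunction.dist_coe_le_dist _) dist_nonneg (by positivity)
    · rw [hneg f t ht, hneg k t ht]
      refine (hσ₂.dist_le_mul _ (f.2.1 _) _ (k.2.1 _)).trans ?_
      exact mul_le_mul (NNReal.coe_le_coe.2 (le_max_right _ _))
        (BoundedContinuousFunction.dist_coe_le_dist _) dist_nonneg (by positivity)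
  have := isClosed_endpointFixing.completeSpace_coe
  have := endpointFixing_nonempty.to_subtype
  obtain ⟨f, hf⟩ : ∃ f, T f = f := ⟨_, hT.fixedPoint_isFixedPt⟩
  have hfix : ∀ t, f.1 t = Φ f t := fun t => by
    conv_lhs => rw [← hf]
    rfl
  have hδ₁ : ∀ t ∈ Iseg, 0 ≤ δ₁ t := fun t ht => by
    rw [← hδ.mid₁]
    exact (strictMonoOn_Iseg_of_deriv_pos hδ.hasDeriv₁ hδ.derivPos₁).monotoneOn hl ht ht.1
  have hδ₂ : ∀ t ∈ Iseg, δ₂ t ≤ 0 := fun t ht => by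
    rw [← hδ.mid₂]
    exact (strictMonoOn_Iseg_of_deriv_pos hδ.hasDeriv₂ hδ.derivPos₂).monotoneOn ht hr ht.2
  refine ⟨f.1, ⟨f.1.continuous.continuousOn, fun t _ => f.2.1 t, fun t ht => ?_, fun t ht => ?_⟩,
    f.2.2⟩
  · rw [hfix, hpos f _ (hδ₁ t ht), hinv₁ t ht]
  · rw [hfix, hneg f _ (hδ₂ t ht), hinv₂ t ht]

/-- If moreover the derivatives of both regular quasi P-configurations are strictly less
than `1`, then the unique intertwining continuous map (which exists) is a homeomorphism of
`I`; in particular the two systems are conjugate. -/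
theorem quasi_pconfig_conjugacy (δ₁ δ₂ d₁ d₂ σ₁ σ₂ e₁ e₂ : ℝ → ℝ)
    (hδ : RegQuasiPConfig δ₁ δ₂ d₁ d₂) (hσ : RegQuasiPConfig σ₁ σ₂ e₁ e₂)
    (he₁ : ∀ t ∈ Iseg, e₁ t < 1) (he₂ : ∀ t ∈ Iseg, e₂ t < 1)
    (hd₁ : ∀ t ∈ Iseg, d₁ t < 1) (hd₂ : ∀ t ∈ Iseg, d₂ t < 1) :
    (∃ h : ℝ → ℝ,
      ContinuousOn h Iseg ∧ MapsTo h Iseg Iseg ∧ h (-1) = -1 ∧ h 0 = 0 ∧ h 1 = 1 ∧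
        (∀ t ∈ Iseg, h (δ₁ t) = σ₁ (h t)) ∧ (∀ t ∈ Iseg, h (δ₂ t) = σ₂ (h t))) ∧
    ∀ h : ℝ → ℝ,
      (ContinuousOn h Iseg ∧ MapsTo h Iseg Iseg ∧ h (-1) = -1 ∧ h 0 = 0 ∧ h 1 = 1 ∧
        (∀ t ∈ Iseg, h (δ₁ t) = σ₁ (h t)) ∧ (∀ t ∈ Iseg, h (δ₂ t) = σ₂ (h t))) →
      IsHomeoOfIcc h := by
  obtain ⟨K₁, hK₁, hLσ₁⟩ :=
    exists_lipschitzOnWith_lt_one hσ.hasDeriv₁ hσ.contDeriv₁ hσ.derivPos₁ he₁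
  obtain ⟨K₂, hK₂, hLσ₂⟩ :=
    exists_lipschitzOnWith_lt_one hσ.hasDeriv₂ hσ.contDeriv₂ hσ.derivPos₂ he₂
  obtain ⟨L₁, hL₁, hLδ₁⟩ :=
    exists_lipschitzOnWith_lt_one hδ.hasDeriv₁ hδ.contDeriv₁ hδ.derivPos₁ hd₁
  obtain ⟨L₂, hL₂, hLδ₂⟩ :=
    exists_lipschitzOnWith_lt_one hδ.hasDeriv₂ hδ.contDeriv₂ hδ.derivPos₂ hd₂
  have hid : ∀ τ₁ τ₂ : ℝ → ℝ, Intertwines τ₁ τ₂ τ₁ τ₂ id := fun _ _ =>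
    ⟨continuousOn_id, mapsTo_id _, fun _ _ => rfl, fun _ _ => rfl⟩
  constructor
  · obtain ⟨h, hh, hl, hr⟩ := exists_intertwines hδ hσ hK₁ hK₂ hLσ₁ hLσ₂
    refine ⟨h, hh.continuousOn, hh.mapsTo, hl, ?_, hr, hh.comm₁, hh.comm₂⟩
    rw [← hδ.mid₁, hh.comm₁ _ (left_mem_Icc.2 (by norm_num)), hl, hσ.mid₁, hδ.mid₁]
  · rintro h ⟨hc, hm, -, -, -, h₁, h₂⟩
    have hh : Intertwines δ₁ δ₂ σ₁ σ₂ h := ⟨hc, hm, h₁, h₂⟩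
    obtain ⟨g, hg, -⟩ := exists_intertwines hσ hδ hL₁ hL₂ hLδ₁ hLδ₂
    exact ⟨hc, hm, g, hg.continuousOn, hg.mapsTo,
      (hg.comp hh).eqOn hδ hL₁ hL₂ hLδ₁ hLδ₂ (hid δ₁ δ₂),
      (hh.comp hg).eqOn hσ hK₁ hK₂ hLσ₁ hLσ₂ (hid σ₁ σ₂)⟩
end

section
/- Let (I, δ₁, δ₂) and (I, σ₁, σ₂) be two regular P-configurations with δ₁ ≠ σ₁ (i.e., δ₁(t₀) ≠ σ₁(t₀) for some t₀ ∈ I). Then no homeomorphism h : I → I satisfying h(δᵢ(t)) = σᵢ(h(t)) for i = 1,2 and all t ∈ I is continuously differentiable; that is, any conjugation between the two P-configurations fails to be C¹. -/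
open Set

/-- `δ₁, δ₂ : I → I` (with derivative functions `d₁, d₂` on `I`) form a *regular
P-configuration* in `I = [-1,1]`: they are `C¹`, `d₁ + d₂ = 1`, both derivatives are
strictly positive, and the endpoint conditions hold. -/
structure RegPConfig (δ₁ δ₂ d₁ d₂ : ℝ → ℝ) : Prop where
  maps₁ : MapsTo δ₁ Iseg Iseg
  maps₂ : MapsTo δ₂ Iseg Iseg
  hasDeriv₁ : ∀ t ∈ Iseg, HasDerivWithinAt δ₁ (d₁ t) Iseg t
  hasDeriv₂ : ∀ t ∈ Iseg, HasDerivWithinAt δ₂ (d₂ t) Iseg t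
  contDeriv₁ : ContinuousOn d₁ Iseg
  contDeriv₂ : ContinuousOn d₂ Iseg
  derivSum : ∀ t ∈ Iseg, d₁ t + d₂ t = 1
  derivPos₁ : ∀ t ∈ Iseg, 0 < d₁ t
  derivPos₂ : ∀ t ∈ Iseg, 0 < d₂ t
  fix₂ : δ₂ (-1) = -1
  mid₂ : δ₂ 1 = 0
  mid₁ : δ₁ (-1) = 0
  fix₁ : δ₁ 1 = 1

theorem eq_of_hasDerivWithinAt_zero {g : ℝ → ℝ}
    (hg : ∀ t ∈ Iseg, HasDerivWithinAt g 0 Iseg t) {s t : ℝ} (hs : s ∈ Iseg) (ht : t ∈ Iseg) :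
    g t = g s := by
  have := (convex_Icc (-1 : ℝ) 1).norm_image_sub_le_of_norm_hasDerivWithin_le (C := 0) hg
    (fun _ _ => by simp) hs ht
  rw [zero_mul, norm_le_zero_iff, sub_eq_zero] at this
  exact this

theorem strictMonoOn_Iseg {g g' : ℝ → ℝ} (hg : ∀ t ∈ Iseg, HasDerivWithinAt g (g' t) Iseg t)
    (hpos : ∀ t ∈ Iseg, 0 < g' t) : StrictMonoOn g Iseg :=
  strictMonoOn_of_hasDerivWithinAt_pos (convex_Icc _ _)
    (fun t ht => (hg t ht).continuousWithinAt)
    (fun t ht => (hg t (interior_subset ht)).mono interior_subset)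
    (fun t ht => hpos t (interior_subset ht))

theorem one_mem_Iseg : (1 : ℝ) ∈ Iseg := by simp [Iseg]

theorem neg_one_mem_Iseg : (-1 : ℝ) ∈ Iseg := by simp [Iseg]

theorem uniqueDiffOn_Iseg : UniqueDiffOn ℝ Iseg := uniqueDiffOn_Icc (by norm_num)

namespace RegPConfig

variable {δ₁ δ₂ d₁ d₂ : ℝ → ℝ}

theorem add_eq (hδ : RegPConfig δ₁ δ₂ d₁ d₂) {t : ℝ} (ht : t ∈ Iseg) : δ₁ t + δ₂ t = t := by
  have key := eq_of_hasDerivWithinAt_zero (g := fun t => δ₁ t + δ₂ t - t)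
    (fun t ht => by
      have := ((hδ.hasDeriv₁ t ht).add (hδ.hasDeriv₂ t ht)).sub (hasDerivWithinAt_id t Iseg)
      rwa [hδ.derivSum t ht, sub_self] at this) one_mem_Iseg ht
  simp only [hδ.fix₁, hδ.mid₂] at key
  linarith

theorem eq_one_of_nonneg (hδ : RegPConfig δ₁ δ₂ d₁ d₂) {t : ℝ} (ht : t ∈ Iseg)
    (h : 0 ≤ δ₂ t) : t = 1 := by
  refine le_antisymm ht.2 ?_
  rwa [← hδ.mid₂,
    (strictMonoOn_Iseg hδ.hasDeriv₂ hδ.derivPos₂).le_iff_le one_mem_Iseg ht] at h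

theorem eq_neg_one_of_eq_zero (hδ : RegPConfig δ₁ δ₂ d₁ d₂) {t : ℝ} (ht : t ∈ Iseg)
    (h : δ₁ t = 0) : t = -1 :=
  (strictMonoOn_Iseg hδ.hasDeriv₁ hδ.derivPos₁).injOn ht neg_one_mem_Iseg
    (h.trans hδ.mid₁.symm)

/-- A continuous function that averages its values along `δ₁, δ₂` attains its maximum at `1`:
the set of maximum points is `δ₁`-invariant, and its largest element can only be `1`. -/
theorem le_apply_one (hδ : RegPConfig δ₁ δ₂ d₁ d₂) {f : ℝ → ℝ} (hf : ContinuousOn f Iseg)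
    (hav : ∀ t ∈ Iseg, f t = f (δ₁ t) * d₁ t + f (δ₂ t) * d₂ t) {t : ℝ} (ht : t ∈ Iseg) :
    f t ≤ f 1 := by
  have hcpt : IsCompact Iseg := isCompact_Icc
  obtain ⟨m, hm, hmax⟩ := hcpt.exists_isMaxOn ⟨1, one_mem_Iseg⟩ hf
  have hmax : ∀ x ∈ Iseg, f x ≤ f m := fun x hx => hmax hx
  have hK : IsCompact (Iseg ∩ f ⁻¹' {f m}) :=
    hcpt.of_isClosed_subset
      (hf.preimage_isClosed_of_isClosed hcpt.isClosed isClosed_singleton) inter_subset_left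
  obtain ⟨s, ⟨hs, hsm⟩, hgt⟩ := hK.exists_isGreatest ⟨m, hm, rfl⟩
  rw [mem_preimage, mem_singleton_iff] at hsm
  have h₁ := hmax _ (hδ.maps₁ hs)
  have h₂ := hmax _ (hδ.maps₂ hs)
  have hinv : f (δ₁ s) = f m := by
    have p₁ := hδ.derivPos₁ s hs
    have p₂ := mul_le_mul_of_nonneg_right h₂ (hδ.derivPos₂ s hs).le
    have hsum : d₂ s = 1 - d₁ s := by linarith [hδ.derivSum s hs]
    have havs := hav s hs
    rw [hsm] at havs
    rw [hsum] at havs p₂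
    by_contra hne
    have := mul_lt_mul_of_pos_right (lt_of_le_of_ne h₁ hne) p₁
    linarith
  have hle : δ₁ s ≤ s := hgt ⟨hδ.maps₁ hs, hinv⟩
  have hs1 : s = 1 := hδ.eq_one_of_nonneg hs (by linarith [hδ.add_eq hs])
  rw [← hs1, hsm]
  exact hmax t ht

theorem eq_apply_one (hδ : RegPConfig δ₁ δ₂ d₁ d₂) {f : ℝ → ℝ} (hf : ContinuousOn f Iseg)
    (hav : ∀ t ∈ Iseg, f t = f (δ₁ t) * d₁ t + f (δ₂ t) * d₂ t) {t : ℝ} (ht : t ∈ Iseg) :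
    f t = f 1 := by
  refine le_antisymm (hδ.le_apply_one hf hav ht) ?_
  have := hδ.le_apply_one (f := fun x => -f x) hf.neg
    (fun t ht => by simp only [hav t ht]; ring) ht
  linarith

end RegPConfig

/-- The chain rule for a conjugation relation `h ∘ δ = σ ∘ h` on `I`. -/
theorem derivWithin_conjugation {h δ d σ e : ℝ → ℝ} (hh : DifferentiableOn ℝ h Iseg)
    (hmaps : MapsTo h Iseg Iseg) (hδmaps : MapsTo δ Iseg Iseg)
    (hδ : ∀ t ∈ Iseg, HasDerivWithinAt δ (d t) Iseg t)
    (hσ : ∀ t ∈ Iseg, HasDerivWithinAt σ (e t) Iseg t)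
    (hconj : ∀ t ∈ Iseg, h (δ t) = σ (h t)) {t : ℝ} (ht : t ∈ Iseg) :
    derivWithin h Iseg (δ t) * d t = e (h t) * derivWithin h Iseg t := by
  have h₁ := (hh _ (hδmaps ht)).hasDerivWithinAt.comp t (hδ t ht) hδmaps
  have h₂ := (hσ _ (hmaps ht)).comp t (hh t ht).hasDerivWithinAt hmaps
  exact (uniqueDiffOn_Iseg t ht).eq_deriv _ (h₁.congr (fun x hx => (hconj x hx).symm)
    (hconj t ht).symm) h₂

/-- A conjugation between two distinct regular P-configurations is never continuously
differentiable. -/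
theorem conjugation_not_C1 (δ₁ δ₂ d₁ d₂ σ₁ σ₂ e₁ e₂ : ℝ → ℝ)
    (hδ : RegPConfig δ₁ δ₂ d₁ d₂) (hσ : RegPConfig σ₁ σ₂ e₁ e₂)
    (hne : ∃ t₀ ∈ Iseg, δ₁ t₀ ≠ σ₁ t₀) :
    ∀ h : ℝ → ℝ, IsHomeoOfIcc h →
      (∀ t ∈ Iseg, h (δ₁ t) = σ₁ (h t)) → (∀ t ∈ Iseg, h (δ₂ t) = σ₂ (h t)) →
      ¬ ContDiffOn ℝ 1 h Iseg := by
  intro h hhomeo hc₁ hc₂ hC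
  have hmaps := hhomeo.2.1
  have hdiff : DifferentiableOn ℝ h Iseg := hC.differentiableOn one_ne_zero
  have hcont : ContinuousOn (derivWithin h Iseg) Iseg :=
    hC.continuousOn_derivWithin uniqueDiffOn_Iseg le_rfl
  have hconst : ∀ t ∈ Iseg, derivWithin h Iseg t = derivWithin h Iseg 1 := fun t ht =>
    hδ.eq_apply_one hcont (fun t ht => by
      rw [derivWithin_conjugation hdiff hmaps hδ.maps₁ hδ.hasDeriv₁ hσ.hasDeriv₁ hc₁ ht,
        derivWithin_conjugation hdiff hmaps hδ.maps₂ hδ.hasDeriv₂ hσ.hasDeriv₂ hc₂ ht,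
        ← add_mul, hσ.derivSum _ (hmaps ht), one_mul]) ht
  have haff : ∀ t ∈ Iseg,
      h t - derivWithin h Iseg 1 * t = h 1 - derivWithin h Iseg 1 * 1 := fun t ht =>
    eq_of_hasDerivWithinAt_zero (g := fun t => h t - derivWithin h Iseg 1 * t)
      (fun t ht => by
        have := (hdiff t ht).hasDerivWithinAt.sub
          ((hasDerivWithinAt_id t Iseg).const_mul (derivWithin h Iseg 1))
        rwa [hconst t ht, mul_one, sub_self] at this) one_mem_Iseg ht
  have h1 : h 1 = 1 := by
    have hfix := hc₁ 1 one_mem_Iseg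
    rw [hδ.fix₁] at hfix
    exact hσ.eq_one_of_nonneg (hmaps one_mem_Iseg)
      (by linarith [hσ.add_eq (hmaps one_mem_Iseg)])
  have hneg1 : h (-1) = -1 := by
    have hfix := hc₂ (-1) neg_one_mem_Iseg
    rw [hδ.fix₂] at hfix
    exact hσ.eq_neg_one_of_eq_zero (hmaps neg_one_mem_Iseg)
      (by linarith [hσ.add_eq (hmaps neg_one_mem_Iseg)])
  have hslope : derivWithin h Iseg 1 = 1 := by
    have := haff (-1) neg_one_mem_Iseg
    linarith
  have hid : ∀ t ∈ Iseg, h t = t := fun t ht => by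
    have := haff t ht
    rw [hslope] at this
    linarith
  obtain ⟨t₀, ht₀, hne⟩ := hne
  apply hne
  rw [← hid _ (hδ.maps₁ ht₀), hc₁ t₀ ht₀, hid t₀ ht₀]
end
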